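/- Let t be a closed term of type ρ* in the star combinatory calculus. Then there exist finitely many closed terms q₁,…,qₙ of type ρ such that IL^ω_* proves w ∈ t ↔ (w = q₁ ∨ … ∨ w = qₙ). -/

import Mathlib

namespace StarCalc

/-- Finite types over a single ground type `G`, closed under `→` and `*`. -/
inductive Ty : Type where
  | ground : Ty
  | arrow : Ty → Ty → Ty
  | star : Ty → Ty
deriving DecidableEq, Repr

/-- The type `G → ⋯ → G → G` with `n` arrows, the type of an `n`-ary function symbol. -/
def fnTy : ℕ → Ty
  | 0 => .ground
  | n + 1 => .arrow .ground (fnTy n)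

/-- Terms of the star combinatory calculus over a family `F` of function symbols
(`F n` = the `n`-ary function symbols of the underlying first-order language). -/
inductive Term (F : ℕ → Type) : Ty → Type where
  | var (n : ℕ) (σ : Ty) : Term F σ
  | fn {n : ℕ} (f : F n) : Term F (fnTy n)
  | pi (σ τ : Ty) : Term F (σ.arrow (τ.arrow σ))
  | sigma (ρ σ τ : Ty) :
      Term F ((ρ.arrow (σ.arrow τ)).arrow ((ρ.arrow σ).arrow (ρ.arrow τ)))
  | sing (σ : Ty) : Term F (σ.arrow σ.star)
  | union (σ : Ty) : Term F (σ.star.arrow (σ.star.arrow σ.star))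
  | bigUnion (σ τ : Ty) : Term F (σ.star.arrow ((σ.arrow τ.star).arrow τ.star))
  | app {σ τ : Ty} (t : Term F (σ.arrow τ)) (q : Term F σ) : Term F τ

variable {F : ℕ → Type}

/-- One-step reduction: apply one of the conversions
`Σtqr ⇝ tr(qr)`, `Πtq ⇝ t`, `⋃(𝔰t)q ⇝ qt`, `⋃(∪tq)r ⇝ ∪(⋃tr)(⋃qr)`
to a subterm. -/
inductive Step : {σ : Ty} → Term F σ → Term F σ → Prop where
  | sigma {ρ σ τ : Ty} (t : Term F (ρ.arrow (σ.arrow τ))) (q : Term F (ρ.arrow σ))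
      (r : Term F ρ) :
      Step ((((Term.sigma ρ σ τ).app t).app q).app r) ((t.app r).app (q.app r))
  | pi {σ τ : Ty} (t : Term F σ) (q : Term F τ) :
      Step (((Term.pi σ τ).app t).app q) t
  | bigUnion_sing {σ τ : Ty} (t : Term F σ) (q : Term F (σ.arrow τ.star)) :
      Step (((Term.bigUnion σ τ).app ((Term.sing σ).app t)).app q) (q.app t)
  | bigUnion_union {σ τ : Ty} (t q : Term F σ.star) (r : Term F (σ.arrow τ.star)) :
      Step (((Term.bigUnion σ τ).app (((Term.union σ).app t).app q)).app r)
        (((Term.union τ).app (((Term.bigUnion σ τ).app t).app r)).app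
          (((Term.bigUnion σ τ).app q).app r))
  | app_left {σ τ : Ty} {t t' : Term F (σ.arrow τ)} (q : Term F σ) :
      Step t t' → Step (t.app q) (t'.app q)
  | app_right {σ τ : Ty} (t : Term F (σ.arrow τ)) {q q' : Term F σ} :
      Step q q' → Step (t.app q) (t.app q')

/-- `t ⪰ q` : `t` reduces to `q` by finitely many (possibly zero) one-step reductions. -/
def Reduces {σ : Ty} (t q : Term F σ) : Prop :=
  Relation.ReflTransGen Step t q

/-- A term is normal if no one-step reduction applies to it. -/
def Normal {σ : Ty} (t : Term F σ) : Prop :=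
  ∀ q : Term F σ, ¬ Step t q

/-- A term is strongly normalizable if there is no infinite chain of one-step
reductions starting from it. -/
def SN {σ : Ty} (t : Term F σ) : Prop :=
  ¬ ∃ f : ℕ → Term F σ, f 0 = t ∧ ∀ n : ℕ, Step (f n) (f (n + 1))

/-- A term is closed if it contains no variables. -/
def Term.ClosedT : {σ : Ty} → Term F σ → Prop
  | _, .var _ _ => False
  | _, .app t q => t.ClosedT ∧ q.ClosedT
  | _, _ => True

end StarCalc

namespace StarCalc
variable {F : ℕ → Type}

/-- The variable `xᵖ` occurs in the term. -/
def Term.hasVar (x : ℕ) (ρ : Ty) : {σ : Ty} → Term F σ → Prop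
  | σ, .var n _ => n = x ∧ σ = ρ
  | _, .app t q => t.hasVar x ρ ∨ q.hasVar x ρ
  | _, _ => False

/-- Substitution `t[s/xᵖ]` of the term `s` (of type `ρ`) for the variable `xᵖ` in a term. -/
def Term.substV : {σ : Ty} → Term F σ → (x : ℕ) → (ρ : Ty) → Term F ρ → Term F σ
  | σ, .var n _, x, ρ, s => if h : n = x ∧ σ = ρ then h.2 ▸ s else .var n σ
  | _, .app t q, x, ρ, s => (t.substV x ρ s).app (q.substV x ρ s)
  | _, t, _, _, _ => t

/-- Strict upper bound for the names of the variables occurring in a term. -/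
def Term.nameBound : {σ : Ty} → Term F σ → ℕ
  | _, .var n _ => n + 1
  | _, .app t q => max t.nameBound q.nameBound
  | _, _ => 0

/-- Formulas of `L^ω_*`: atomic formulas `⊥`, `R(t₁,…,tₙ)`, `t =ρ q`, `t ∈ρ q`,
connectives `∨, ∧, →`, unbounded quantifiers `∀xᵖ, ∃xᵖ` and bounded quantifiers
`∀xᵖ ∈ t, ∃xᵖ ∈ t` (`t` of star type).  `R n` is the family of `n`-ary relation
symbols of the underlying first-order language. -/
inductive Formula (F R : ℕ → Type) : Type where
  | bot : Formula F R
  | rel {n : ℕ} (r : R n) (ts : Fin n → Term F .ground) : Formula F R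
  | eq {σ : Ty} (t q : Term F σ) : Formula F R
  | mem {σ : Ty} (t : Term F σ) (q : Term F σ.star) : Formula F R
  | or (A B : Formula F R) : Formula F R
  | and (A B : Formula F R) : Formula F R
  | imp (A B : Formula F R) : Formula F R
  | all (x : ℕ) (σ : Ty) (A : Formula F R) : Formula F R
  | ex (x : ℕ) (σ : Ty) (A : Formula F R) : Formula F R
  | ball (x : ℕ) (σ : Ty) (t : Term F σ.star) (A : Formula F R) : Formula F R
  | bex (x : ℕ) (σ : Ty) (t : Term F σ.star) (A : Formula F R) : Formula F R

variable {R : ℕ → Type}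

/-- `¬A` abbreviates `A → ⊥`. -/
def Formula.not (A : Formula F R) : Formula F R := A.imp .bot

/-- `A ↔ B` abbreviates `(A → B) ∧ (B → A)`. -/
def Formula.iff (A B : Formula F R) : Formula F R := (A.imp B).and (B.imp A)

/-- A trivially provable formula `⊥ → ⊥`. -/
def Formula.top : Formula F R := Formula.bot.imp .bot

/-- The variable `xᵖ` occurs free in the formula. -/
def Formula.freeVar (x : ℕ) (ρ : Ty) : Formula F R → Prop
  | .bot => False
  | .rel _ ts => ∃ i, (ts i).hasVar x ρ
  | .eq t q => t.hasVar x ρ ∨ q.hasVar x ρ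
  | .mem t q => t.hasVar x ρ ∨ q.hasVar x ρ
  | .or A B => A.freeVar x ρ ∨ B.freeVar x ρ
  | .and A B => A.freeVar x ρ ∨ B.freeVar x ρ
  | .imp A B => A.freeVar x ρ ∨ B.freeVar x ρ
  | .all y σ A => ¬(y = x ∧ σ = ρ) ∧ A.freeVar x ρ
  | .ex y σ A => ¬(y = x ∧ σ = ρ) ∧ A.freeVar x ρ
  | .ball y σ t A => t.hasVar x ρ ∨ (¬(y = x ∧ σ = ρ) ∧ A.freeVar x ρ)
  | .bex y σ t A => t.hasVar x ρ ∨ (¬(y = x ∧ σ = ρ) ∧ A.freeVar x ρ)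

/-- A formula is closed if it has no free variables. -/
def Formula.ClosedF (A : Formula F R) : Prop := ∀ (x : ℕ) (ρ : Ty), ¬ A.freeVar x ρ

/-- Substitution `A[s/xᵖ]` of a term `s` of type `ρ` for the (free occurrences of
the) variable `xᵖ` in a formula. -/
def Formula.subst (x : ℕ) (ρ : Ty) (s : Term F ρ) : Formula F R → Formula F R
  | .bot => .bot
  | .rel r ts => .rel r fun i => (ts i).substV x ρ s
  | .eq t q => .eq (t.substV x ρ s) (q.substV x ρ s)
  | .mem t q => .mem (t.substV x ρ s) (q.substV x ρ s)
  | .or A B => .or (A.subst x ρ s) (B.subst x ρ s)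
  | .and A B => .and (A.subst x ρ s) (B.subst x ρ s)
  | .imp A B => .imp (A.subst x ρ s) (B.subst x ρ s)
  | .all y σ A => if y = x ∧ σ = ρ then .all y σ A else .all y σ (A.subst x ρ s)
  | .ex y σ A => if y = x ∧ σ = ρ then .ex y σ A else .ex y σ (A.subst x ρ s)
  | .ball y σ t A =>
      if y = x ∧ σ = ρ then .ball y σ (t.substV x ρ s) A
      else .ball y σ (t.substV x ρ s) (A.subst x ρ s)
  | .bex y σ t A =>
      if y = x ∧ σ = ρ then .bex y σ (t.substV x ρ s) A
      else .bex y σ (t.substV x ρ s) (A.subst x ρ s)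

/-- The term `s` is free for the variable `xᵖ` in the formula (no free occurrence
of `xᵖ` lies in the scope of a quantifier binding a variable of `s`). -/
def FreeFor (x : ℕ) (ρ : Ty) (s : Term F ρ) : Formula F R → Prop
  | .bot => True
  | .rel _ _ => True
  | .eq _ _ => True
  | .mem _ _ => True
  | .or A B => FreeFor x ρ s A ∧ FreeFor x ρ s B
  | .and A B => FreeFor x ρ s A ∧ FreeFor x ρ s B
  | .imp A B => FreeFor x ρ s A ∧ FreeFor x ρ s B
  | .all y σ A => ¬ (Formula.all y σ A).freeVar x ρ ∨ (¬ s.hasVar y σ ∧ FreeFor x ρ s A)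
  | .ex y σ A => ¬ (Formula.ex y σ A).freeVar x ρ ∨ (¬ s.hasVar y σ ∧ FreeFor x ρ s A)
  | .ball y σ t A =>
      ¬ (Formula.ball y σ t A).freeVar x ρ ∨ (¬ s.hasVar y σ ∧ FreeFor x ρ s A)
  | .bex y σ t A =>
      ¬ (Formula.bex y σ t A).freeVar x ρ ∨ (¬ s.hasVar y σ ∧ FreeFor x ρ s A)

/-- A formula is `∃`-free if it contains no unbounded existential quantifiers. -/
def Formula.existsFree : Formula F R → Prop
  | .ex _ _ _ => False
  | .or A B => A.existsFree ∧ B.existsFree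
  | .and A B => A.existsFree ∧ B.existsFree
  | .imp A B => A.existsFree ∧ B.existsFree
  | .all _ _ A => A.existsFree
  | .ball _ _ _ A => A.existsFree
  | .bex _ _ _ A => A.existsFree
  | _ => True

/-- `Repl x y ρ t t'` : `t'` is obtained from `t` by replacing some (possibly
none, possibly all) occurrences of the variable `xᵖ` by the variable `yᵖ`. -/
inductive Repl (x y : ℕ) (ρ : Ty) : {σ : Ty} → Term F σ → Term F σ → Prop where
  | refl {σ : Ty} (t : Term F σ) : Repl x y ρ t t
  | var : Repl x y ρ (Term.var x ρ) (Term.var y ρ)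
  | app {σ τ : Ty} {t t' : Term F (σ.arrow τ)} {q q' : Term F σ} :
      Repl x y ρ t t' → Repl x y ρ q q' → Repl x y ρ (t.app q) (t'.app q')

/-- `ReplAtom x y ρ A A'` : `A` is atomic and `A'` is obtained from `A` replacing
some instances of the variable `xᵖ` by `yᵖ`. -/
inductive ReplAtom (x y : ℕ) (ρ : Ty) : Formula F R → Formula F R → Prop where
  | bot : ReplAtom x y ρ .bot .bot
  | rel {n : ℕ} (r : R n) (ts ts' : Fin n → Term F .ground) :
      (∀ i, Repl x y ρ (ts i) (ts' i)) → ReplAtom x y ρ (.rel r ts) (.rel r ts')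
  | eq {σ : Ty} {t t' q q' : Term F σ} :
      Repl x y ρ t t' → Repl x y ρ q q' → ReplAtom x y ρ (.eq t q) (.eq t' q')
  | mem {σ : Ty} {t t' : Term F σ} {q q' : Term F σ.star} :
      Repl x y ρ t t' → Repl x y ρ q q' → ReplAtom x y ρ (.mem t q) (.mem t' q')

/-- Derivability in the theory `IL^ω_* + T` : intuitionistic logic in all finite
(star) types, with the axioms for `=` and the star constants, the combinator
axioms, the bounded-quantifier axioms, plus the formulas of `T` as extra axioms. -/
inductive Proves (T : Set (Formula F R)) : Formula F R → Prop where
  -- extra axioms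
  | hyp {A : Formula F R} : A ∈ T → Proves T A
  -- axioms of IL
  | or_idem (A : Formula F R) : Proves T ((A.or A).imp A)
  | and_dup (A : Formula F R) : Proves T (A.imp (A.and A))
  | or_inl (A B : Formula F R) : Proves T (A.imp (A.or B))
  | and_elim (A B : Formula F R) : Proves T ((A.and B).imp A)
  | and_comm (A B : Formula F R) : Proves T ((A.and B).imp (B.and A))
  | or_comm (A B : Formula F R) : Proves T ((A.or B).imp (B.or A))
  | exfalso (A : Formula F R) : Proves T (Formula.bot.imp A)
  | all_inst {x : ℕ} {ρ : Ty} (s : Term F ρ) (A : Formula F R) :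
      FreeFor x ρ s A → Proves T ((Formula.all x ρ A).imp (A.subst x ρ s))
  | ex_intro {x : ℕ} {ρ : Ty} (s : Term F ρ) (A : Formula F R) :
      FreeFor x ρ s A → Proves T ((A.subst x ρ s).imp (Formula.ex x ρ A))
  -- rules of IL
  | mp {A B : Formula F R} : Proves T A → Proves T (A.imp B) → Proves T B
  | syl {A B C : Formula F R} :
      Proves T (A.imp B) → Proves T (B.imp C) → Proves T (A.imp C)
  | or_mono {A B C : Formula F R} :
      Proves T (A.imp B) → Proves T ((C.or A).imp (C.or B))
  | exp {A B C : Formula F R} :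
      Proves T ((A.and B).imp C) → Proves T (A.imp (B.imp C))
  | imp' {A B C : Formula F R} :
      Proves T (A.imp (B.imp C)) → Proves T ((A.and B).imp C)
  | all_intro {x : ℕ} {ρ : Ty} {A B : Formula F R} : ¬ B.freeVar x ρ →
      Proves T (B.imp A) → Proves T (B.imp (.all x ρ A))
  | ex_elim {x : ℕ} {ρ : Ty} {A B : Formula F R} : ¬ B.freeVar x ρ →
      Proves T (A.imp B) → Proves T ((Formula.ex x ρ A).imp B)
  -- equality axioms
  | eq_refl (x : ℕ) (ρ : Ty) : Proves T (.eq (Term.var x ρ) (Term.var x ρ))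
  | eq_subst {x y : ℕ} {ρ : Ty} {A A' : Formula F R} : ReplAtom x y ρ A A' →
      Proves T (((Formula.eq (Term.var x ρ) (Term.var y ρ)).and A).imp A')
  -- bounded quantifier axioms
  | ball_char {x : ℕ} {σ : Ty} (t : Term F σ.star) (A : Formula F R) :
      ¬ t.hasVar x σ →
      Proves T ((Formula.ball x σ t A).iff
        (.all x σ ((Formula.mem (Term.var x σ) t).imp A)))
  | bex_char {x : ℕ} {σ : Ty} (t : Term F σ.star) (A : Formula F R) :
      ¬ t.hasVar x σ →
      Proves T ((Formula.bex x σ t A).iff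
        (.ex x σ ((Formula.mem (Term.var x σ) t).and A)))
  -- combinator axioms
  | sigma_ax {ρ σ τ : Ty} (t : Term F (ρ.arrow (σ.arrow τ))) (q : Term F (ρ.arrow σ))
      (r : Term F ρ) :
      Proves T (.eq ((((Term.sigma ρ σ τ).app t).app q).app r) ((t.app r).app (q.app r)))
  | pi_ax {σ τ : Ty} (t : Term F σ) (q : Term F τ) :
      Proves T (.eq (((Term.pi σ τ).app t).app q) t)
  -- star axioms
  | mem_sing {σ : Ty} (w a : Term F σ) :
      Proves T ((Formula.mem w ((Term.sing σ).app a)).iff (.eq w a))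
  | mem_union {σ : Ty} (w : Term F σ) (a b : Term F σ.star) :
      Proves T ((Formula.mem w (((Term.union σ).app a).app b)).iff
        ((Formula.mem w a).or (.mem w b)))
  | mem_bigUnion {σ τ : Ty} (z : Term F σ) (a : Term F σ.star)
      (b : Term F (σ.arrow τ.star)) (w : Term F τ) :
      Proves T (((Formula.mem z a).and (.mem w (b.app z))).imp
        (.mem w (((Term.bigUnion σ τ).app a).app b)))
  | bigUnion_sing {σ τ : Ty} (a : Term F σ) (b : Term F (σ.arrow τ.star)) :
      Proves T (.eq (((Term.bigUnion σ τ).app ((Term.sing σ).app a)).app b) (b.app a))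
  | bigUnion_union {σ τ : Ty} (a b : Term F σ.star) (c : Term F (σ.arrow τ.star)) :
      Proves T (.eq (((Term.bigUnion σ τ).app (((Term.union σ).app a).app b)).app c)
        (((Term.union τ).app (((Term.bigUnion σ τ).app a).app c)).app
          (((Term.bigUnion σ τ).app b).app c)))

/-- The axiom scheme `AC^ω_*` :
`∀xᵖ ∃yᵠ A(x,y) → ∃f^{ρ→σ*} ∀x ∃y ∈ fx A(x,y)` (`f` fresh). -/
def ACset (F R : ℕ → Type) : Set (Formula F R) :=
  { C | ∃ (x y f : ℕ) (ρ σ : Ty) (A : Formula F R),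
      ¬ A.freeVar f (ρ.arrow σ.star) ∧ (f, ρ.arrow σ.star) ≠ (x, ρ) ∧
      (f, ρ.arrow σ.star) ≠ (y, σ) ∧ (x, ρ) ≠ (y, σ) ∧
      C = (Formula.all x ρ (.ex y σ A)).imp
        (.ex f (ρ.arrow σ.star) (.all x ρ
          (.bex y σ ((Term.var f (ρ.arrow σ.star)).app (Term.var x ρ)) A))) }

/-- The axiom scheme `IP^*_∄` :
`(B → ∃y A(y)) → ∃w (B → ∃y ∈ w A(y))` for `B` an `∃`-free formula (`w` fresh). -/
def IPset (F R : ℕ → Type) : Set (Formula F R) :=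
  { C | ∃ (y w : ℕ) (σ : Ty) (A B : Formula F R),
      B.existsFree ∧
      ¬ A.freeVar w σ.star ∧ ¬ B.freeVar w σ.star ∧ ¬ B.freeVar y σ ∧
      (w, σ.star) ≠ (y, σ) ∧
      C = (B.imp (.ex y σ A)).imp
        (.ex w σ.star (B.imp (.bex y σ (Term.var w σ.star) A))) }

/-- Iterated universal quantification `∀x̲ A` over a tuple of variables. -/
def alls : List (ℕ × Ty) → Formula F R → Formula F R := fun l A =>
  l.foldr (fun p B => .all p.1 p.2 B) A

/-- Iterated existential quantification `∃x̲ A` over a tuple of variables. -/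
def exs : List (ℕ × Ty) → Formula F R → Formula F R := fun l A =>
  l.foldr (fun p B => .ex p.1 p.2 B) A

/-- The type `ρ₁ → ⋯ → ρₙ → τ`. -/
def arrTy : List Ty → Ty → Ty := fun l τ => l.foldr .arrow τ

/-- Application of a term of type `ρ₁ → ⋯ → ρₙ → τ` to a tuple of variables of
types `ρ₁, …, ρₙ`. -/
def appVars {ρ : Ty} : (zs : List (ℕ × Ty)) → Term F (arrTy (zs.map Prod.snd) ρ) →
    Term F ρ
  | [], t => t
  | (x, σ) :: zs, t => appVars zs (t.app (Term.var x σ))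

/-- A single substitution instruction: replace variable `x` of type `ρ` by a term. -/
structure SubstOne (F : ℕ → Type) : Type where
  ρ : Ty
  x : ℕ
  s : Term F ρ

/-- Simultaneous (sequential) substitution of a list of terms for a list of variables. -/
def Formula.msubst (A : Formula F R) (l : List (SubstOne F)) : Formula F R :=
  l.foldl (fun B u => B.subst u.x u.ρ u.s) A

/-- Strict upper bound for the names of all (free or bound) variables of a formula. -/
def Formula.nameBound : Formula F R → ℕ
  | .bot => 0
  | .rel _ ts => Finset.univ.sup fun i => (ts i).nameBound
  | .eq t q => max t.nameBound q.nameBound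
  | .mem t q => max t.nameBound q.nameBound
  | .or A B => max A.nameBound B.nameBound
  | .and A B => max A.nameBound B.nameBound
  | .imp A B => max A.nameBound B.nameBound
  | .all y _ A => max (y + 1) A.nameBound
  | .ex y _ A => max (y + 1) A.nameBound
  | .ball y _ t A => max (y + 1) (max t.nameBound A.nameBound)
  | .bex y _ t A => max (y + 1) (max t.nameBound A.nameBound)

end StarCalc

namespace StarCalc
variable {F R : ℕ → Type} {T : Set (Formula F R)}

namespace Proves

theorem imp_id (A : Formula F R) : Proves T (A.imp A) :=
  .syl (.and_dup A) (.and_elim A A)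

theorem imp_const (A B : Formula F R) : Proves T (A.imp (B.imp A)) :=
  .exp (.and_elim A B)

theorem and_intro {A B : Formula F R} (hA : Proves T A) (hB : Proves T B) :
    Proves T (A.and B) :=
  .mp hB (.mp hA (.exp (imp_id _)))

theorem and_left {A B : Formula F R} (h : Proves T (A.and B)) : Proves T A :=
  .mp h (.and_elim A B)

theorem and_right {A B : Formula F R} (h : Proves T (A.and B)) : Proves T B :=
  and_left (.mp h (.and_comm A B))

theorem or_inr (A B : Formula F R) : Proves T (B.imp (A.or B)) :=
  .syl (.or_inl B A) (.or_comm B A)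

theorem or_elim {A B C : Formula F R} (hA : Proves T (A.imp C)) (hB : Proves T (B.imp C)) :
    Proves T ((A.or B).imp C) :=
  .syl (.or_mono hB) (.syl (.or_comm A C) (.syl (.or_mono hA) (.or_idem C)))

theorem iff_trans {A B C : Formula F R} (h₁ : Proves T (A.iff B)) (h₂ : Proves T (B.iff C)) :
    Proves T (A.iff C) :=
  and_intro (.syl (and_left h₁) (and_left h₂)) (.syl (and_right h₂) (and_right h₁))

theorem or_congr {A A' B B' : Formula F R} (h₁ : Proves T (A.iff A')) (h₂ : Proves T (B.iff B')) :
    Proves T ((A.or B).iff (A'.or B')) :=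
  and_intro
    (or_elim (.syl (and_left h₁) (.or_inl _ _)) (.syl (and_left h₂) (or_inr _ _)))
    (or_elim (.syl (and_right h₁) (.or_inl _ _)) (.syl (and_right h₂) (or_inr _ _)))

theorem generalize {A : Formula F R} (x : ℕ) (ρ : Ty) (h : Proves T A) :
    Proves T (.all x ρ A) :=
  .mp (imp_id .bot) (.all_intro (B := .top) (by simp [Formula.top, Formula.freeVar])
    (.mp h (imp_const _ _)))

theorem inst {A : Formula F R} {x : ℕ} {ρ : Ty} (s : Term F ρ) (hA : FreeFor x ρ s A)
    (h : Proves T A) : Proves T (A.subst x ρ s) :=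
  .mp (generalize x ρ h) (.all_inst s A hA)

end Proves

theorem Term.ClosedT.substV_eq {σ : Ty} {t : Term F σ} (ht : t.ClosedT) (x : ℕ) (ρ : Ty)
    (s : Term F ρ) : t.substV x ρ s = t := by
  induction t with
  | var => exact ht.elim
  | app t q iht ihq => simp only [Term.substV, iht ht.1, ihq ht.2]
  | _ => simp only [Term.substV]

theorem Term.substV_app {σ τ : Ty} (t : Term F (σ.arrow τ)) (q : Term F σ) (x : ℕ) (ρ : Ty)
    (s : Term F ρ) : (t.app q).substV x ρ s = (t.substV x ρ s).app (q.substV x ρ s) :=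
  rfl

theorem Term.substV_var_self (x : ℕ) (ρ : Ty) (s : Term F ρ) :
    (Term.var x ρ).substV x ρ s = s := by
  simp [Term.substV]

theorem Term.substV_var_of_ne {n x : ℕ} (h : n ≠ x) (σ ρ : Ty) (s : Term F ρ) :
    (Term.var n σ).substV x ρ s = .var n σ := by
  simp [Term.substV, h]

theorem ReplAtom.freeFor {x y z : ℕ} {ρ σ : Ty} {s : Term F σ} {A A' : Formula F R}
    (h : ReplAtom x y ρ A A') : FreeFor z σ s A ∧ FreeFor z σ s A' := by
  cases h <;> simp [FreeFor]

theorem ReplAtom.freeFor_subst {x y z v : ℕ} {ρ σ τ : Ty} {s : Term F σ} {u : Term F τ}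
    {A A' : Formula F R} (h : ReplAtom x y ρ A A') :
    FreeFor z σ s (A.subst v τ u) ∧ FreeFor z σ s (A'.subst v τ u) := by
  cases h <;> simp [FreeFor, Formula.subst]

namespace Proves

/-- Replacement of provably equal closed terms in atomic formulas. -/
theorem leibniz {x y : ℕ} {ρ : Ty} {s s' : Term F ρ} {A A' : Formula F R} (hxy : x ≠ y)
    (hA : ReplAtom x y ρ A A') (hs : s.ClosedT) (h : Proves T (.eq s s')) :
    Proves T (((A.subst x ρ s).subst y ρ s').imp ((A'.subst x ρ s).subst y ρ s')) := by
  have h₀ : Proves T ((Formula.eq (Term.var x ρ) (Term.var y ρ)).imp (A.imp A')) :=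
    .exp (eq_subst hA)
  have h₁ := inst (x := y) s' (by exact ⟨trivial, hA.freeFor_subst.1, hA.freeFor_subst.2⟩)
    (inst (x := x) s (by exact ⟨trivial, hA.freeFor.1, hA.freeFor.2⟩) h₀)
  simp only [Formula.subst, Term.substV_var_self, Term.substV_var_of_ne hxy.symm,
    hs.substV_eq] at h₁
  exact .mp h h₁

theorem eq_refl_term {ρ : Ty} (s : Term F ρ) : Proves T (.eq s s) := by
  simpa only [Formula.subst, Term.substV_var_self] using
    inst (A := .eq (Term.var 0 ρ) (Term.var 0 ρ)) (x := 0) s (by exact trivial)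
      (eq_refl (T := T) 0 ρ)

theorem eq_symm {ρ : Ty} {s s' : Term F ρ} (hs : s.ClosedT)
    (h : Proves T (.eq s s')) : Proves T (.eq s' s) := by
  have h₁ := leibniz (T := T) (x := 0) (y := 1) (by decide)
    (.eq .var (.refl (Term.var 0 ρ))) hs h
  simp only [Formula.subst, Term.substV_var_self, hs.substV_eq,
    Term.substV_var_of_ne (show 1 ≠ 0 by decide)] at h₁
  exact .mp (eq_refl_term s) h₁

theorem app_congr_left {σ τ : Ty} {s s' : Term F (σ.arrow τ)} {u : Term F σ} (hs : s.ClosedT)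
    (hu : u.ClosedT) (h : Proves T (.eq s s')) : Proves T (.eq (s.app u) (s'.app u)) := by
  have h₁ := leibniz (T := T) (x := 0) (y := 1) (by decide)
    (.eq (.refl ((Term.var 0 (σ.arrow τ)).app u)) (.app .var (.refl u))) hs h
  simp only [Formula.subst, Term.substV_app, Term.substV_var_self, hs.substV_eq, hu.substV_eq,
    Term.substV_var_of_ne (show 1 ≠ 0 by decide)] at h₁
  exact .mp (eq_refl_term _) h₁

theorem app_congr_right {σ τ : Ty} {u : Term F (σ.arrow τ)} {s s' : Term F σ} (hu : u.ClosedT)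
    (hs : s.ClosedT) (h : Proves T (.eq s s')) : Proves T (.eq (u.app s) (u.app s')) := by
  have h₁ := leibniz (T := T) (x := 0) (y := 1) (by decide)
    (.eq (.refl (u.app (Term.var 0 σ))) (.app (.refl u) .var)) hs h
  simp only [Formula.subst, Term.substV_app, Term.substV_var_self, hs.substV_eq, hu.substV_eq,
    Term.substV_var_of_ne (show 1 ≠ 0 by decide)] at h₁
  exact .mp (eq_refl_term _) h₁

theorem mem_imp_of_eq {σ : Ty} {s s' : Term F σ.star} (hs : s.ClosedT)
    (h : Proves T (.eq s s')) (w : ℕ) :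
    Proves T ((Formula.mem (Term.var w σ) s).imp (.mem (Term.var w σ) s')) := by
  have h₁ := leibniz (T := T) (x := w + 1) (y := w + 2) (by omega)
    (.mem (.refl (Term.var w σ)) .var) hs h
  simpa only [Formula.subst, Term.substV_var_self, hs.substV_eq,
    Term.substV_var_of_ne (show w ≠ w + 1 by omega),
    Term.substV_var_of_ne (show w ≠ w + 2 by omega),
    Term.substV_var_of_ne (show w + 2 ≠ w + 1 by omega)] using h₁

theorem mem_congr {σ : Ty} {s s' : Term F σ.star} (hs : s.ClosedT) (hs' : s'.ClosedT)
    (h : Proves T (.eq s s')) (w : ℕ) :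
    Proves T ((Formula.mem (Term.var w σ) s).iff (.mem (Term.var w σ) s')) :=
  and_intro (mem_imp_of_eq hs h w) (mem_imp_of_eq hs' (eq_symm hs h) w)

theorem imp_foldl_or (A : Formula F R) (l : List (Formula F R)) :
    Proves T (A.imp (l.foldl .or A)) := by
  induction l generalizing A with
  | nil => exact imp_id A
  | cons B l ih => exact .syl (.or_inl A B) (ih _)

theorem foldl_or_elim {A C : Formula F R} {l : List (Formula F R)} (hA : Proves T (A.imp C))
    (hl : ∀ B ∈ l, Proves T (B.imp C)) : Proves T ((l.foldl .or A).imp C) := by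
  induction l generalizing A with
  | nil => exact hA
  | cons B l ih =>
    exact ih (or_elim hA (hl B (by simp))) fun B' hB' => hl B' (by simp [hB'])

theorem imp_foldl_or_of_mem {A B : Formula F R} {l : List (Formula F R)} (hB : B ∈ l) :
    Proves T (B.imp (l.foldl .or A)) := by
  induction l generalizing A with
  | nil => simp at hB
  | cons C l ih =>
    rcases List.mem_cons.1 hB with rfl | hB
    · exact .syl (or_inr A B) (imp_foldl_or _ l)
    · exact ih hB

theorem foldl_or_append (A B : Formula F R) (l m : List (Formula F R)) :
    Proves T (((l.foldl .or A).or (m.foldl .or B)).iff ((l ++ B :: m).foldl .or A)) := by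
  refine and_intro (or_elim ?_ ?_) ?_
  · exact foldl_or_elim (imp_foldl_or _ _) fun C hC => imp_foldl_or_of_mem (by simp [hC])
  · exact foldl_or_elim (imp_foldl_or_of_mem (by simp))
      fun C hC => imp_foldl_or_of_mem (by simp [hC])
  · refine foldl_or_elim (.syl (imp_foldl_or A l) (.or_inl _ _)) fun C hC => ?_
    rcases List.mem_append.1 hC with hC | hC
    · exact .syl (imp_foldl_or_of_mem hC) (.or_inl _ _)
    rcases List.mem_cons.1 hC with rfl | hC
    · exact .syl (imp_foldl_or C m) (or_inr _ _)
    · exact .syl (imp_foldl_or_of_mem hC) (or_inr _ _)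

end Proves

/-- Star-type terms provably equal to a finite union of singletons of terms satisfying `P`. -/
inductive FinSet (T : Set (Formula F R)) {σ : Ty} (P : Term F σ → Prop) :
    Term F σ.star → Prop where
  | sing {a : Term F σ} : P a → FinSet T P ((Term.sing σ).app a)
  | union {a b : Term F σ.star} : FinSet T P a → FinSet T P b →
      FinSet T P (((Term.union σ).app a).app b)
  | eq {a b : Term F σ.star} : a.ClosedT → Proves T (.eq a b) → FinSet T P b → FinSet T P a

/-- Tait-style computability of closed terms, by recursion on the type. -/
def Computable (T : Set (Formula F R)) : (σ : Ty) → Term F σ → Prop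
  | .ground, t => t.ClosedT
  | .arrow σ τ, t => t.ClosedT ∧ ∀ s : Term F σ, Computable T σ s → Computable T τ (t.app s)
  | .star σ, t => FinSet T (Computable T σ) t

theorem FinSet.closed {σ : Ty} {P : Term F σ → Prop} (hP : ∀ a, P a → a.ClosedT)
    {t : Term F σ.star} (h : FinSet T P t) : t.ClosedT := by
  induction h with
  | sing ha => exact ⟨trivial, hP _ ha⟩
  | union _ _ iha ihb => exact ⟨⟨trivial, iha⟩, ihb⟩
  | eq ha _ _ _ => exact ha

theorem Computable.closed {σ : Ty} {t : Term F σ} (h : Computable T σ t) : t.ClosedT := by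
  induction σ with
  | ground => exact h
  | arrow => exact h.1
  | star σ ih => exact FinSet.closed (fun _ => ih) h

theorem Computable.of_eq {σ : Ty} {t t' : Term F σ} (ht : t.ClosedT)
    (h : Proves T (.eq t t')) (h' : Computable T σ t') : Computable T σ t := by
  induction σ with
  | ground => exact ht
  | arrow σ τ _ ih =>
    exact ⟨ht, fun s hs => ih ⟨ht, hs.closed⟩ (.app_congr_left ht hs.closed h) (h'.2 s hs)⟩
  | star σ => exact .eq ht h h'

theorem computable_of_closed_fnTy {n : ℕ} {t : Term F (fnTy n)} (ht : t.ClosedT) :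
    Computable T (fnTy n) t := by
  induction n with
  | zero => exact ht
  | succ n ih => exact ⟨ht, fun s hs => ih ⟨ht, hs.closed⟩⟩

theorem FinSet.bigUnion {σ τ : Ty} {a : Term F σ.star} {b : Term F (σ.arrow τ.star)}
    (ha : FinSet T (Computable T σ) a) (hb : Computable T (σ.arrow τ.star) b) :
    FinSet T (Computable T τ) (((Term.bigUnion σ τ).app a).app b) := by
  have hcl : ∀ {a : Term F σ.star}, FinSet T (Computable T σ) a → a.ClosedT :=
    FinSet.closed fun _ => Computable.closed
  induction ha with
  | sing ha =>
    exact .eq ⟨⟨trivial, trivial, ha.closed⟩, hb.1⟩ (.bigUnion_sing _ _) (hb.2 _ ha)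
  | union hx hy ihx ihy =>
    exact .eq ⟨⟨trivial, ⟨trivial, hcl hx⟩, hcl hy⟩, hb.1⟩ (.bigUnion_union _ _ _)
      (.union ihx ihy)
  | eq hx h _ ih =>
    exact .eq ⟨⟨trivial, hx⟩, hb.1⟩
      (.app_congr_left ⟨trivial, hx⟩ hb.1 (.app_congr_right trivial hx h)) ih

theorem Term.ClosedT.computable {σ : Ty} {t : Term F σ} (ht : t.ClosedT) :
    Computable T σ t := by
  induction t with
  | var => exact ht.elim
  | fn f => exact computable_of_closed_fnTy ht
  | pi σ τ =>
    refine ⟨trivial, fun t h => ⟨⟨trivial, h.closed⟩, fun q hq => ?_⟩⟩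
    exact .of_eq ⟨⟨trivial, h.closed⟩, hq.closed⟩ (.pi_ax t q) h
  | sigma ρ σ τ =>
    refine ⟨trivial, fun t h => ⟨⟨trivial, h.closed⟩, fun q hq =>
      ⟨⟨⟨trivial, h.closed⟩, hq.closed⟩, fun r hr => ?_⟩⟩⟩
    exact .of_eq ⟨⟨⟨trivial, h.closed⟩, hq.closed⟩, hr.closed⟩ (.sigma_ax t q r)
      ((h.2 r hr).2 _ (hq.2 r hr))
  | sing σ => exact ⟨trivial, fun a ha => .sing ha⟩
  | union σ =>
    exact ⟨trivial, fun a ha => ⟨⟨trivial, ha.closed⟩, fun b hb => .union ha hb⟩⟩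
  | bigUnion σ τ =>
    exact ⟨trivial, fun a ha => ⟨⟨trivial, ha.closed⟩, fun b hb => FinSet.bigUnion ha hb⟩⟩
  | app t q iht ihq => exact (iht ht.1).2 q (ihq ht.2)

theorem FinSet.exists_mem_iff {σ : Ty} {P : Term F σ → Prop} (hP : ∀ a, P a → a.ClosedT)
    {t : Term F σ.star} (h : FinSet T P t) :
    ∃ (q : Term F σ) (qs : List (Term F σ)), P q ∧ (∀ q' ∈ qs, P q') ∧
      ∀ w : ℕ, Proves T ((Formula.mem (Term.var w σ) t).iff
        ((qs.map fun q' => Formula.eq (Term.var w σ) q').foldl Formula.or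
          (Formula.eq (Term.var w σ) q))) := by
  induction h with
  | @sing a ha => exact ⟨a, [], ha, by simp, fun w => .mem_sing _ _⟩
  | union _ _ iha ihb =>
    obtain ⟨q, qs, hq, hqs, h⟩ := iha
    obtain ⟨r, rs, hr, hrs, h'⟩ := ihb
    refine ⟨q, qs ++ r :: rs, hq, ?_, fun w => ?_⟩
    · simp only [List.mem_append, List.mem_cons]
      rintro q' (h | rfl | h)
      exacts [hqs _ h, hr, hrs _ h]
    · rw [List.map_append, List.map_cons]
      exact (Proves.mem_union _ _ _).iff_trans
        ((Proves.or_congr (h w) (h' w)).iff_trans (Proves.foldl_or_append _ _ _ _))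
  | eq ha hab hb ih =>
    obtain ⟨q, qs, hq, hqs, h⟩ := ih
    exact ⟨q, qs, hq, hqs, fun w => (Proves.mem_congr ha (hb.closed hP) hab w).iff_trans (h w)⟩

end StarCalc

open StarCalc in
/-- If `t` is a closed term of type `ρ*` then there are closed terms
`q₁, …, qₙ` of type `ρ` such that `IL^ω_*` proves `w ∈ t ↔ (w = q₁ ∨ … ∨ w = qₙ)`. -/
theorem closed_star_term_is_provably_a_finite_set (F R : ℕ → Type) (c : F 0)
    {ρ : Ty} (t : Term F ρ.star) (hclosed : t.ClosedT) :
    ∃ (q : Term F ρ) (qs : List (Term F ρ)),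
      q.ClosedT ∧ (∀ q' ∈ qs, q'.ClosedT) ∧
      ∀ w : ℕ,
        Proves (∅ : Set (Formula F R))
          ((Formula.mem (Term.var w ρ) t).iff
            ((qs.map fun q' => Formula.eq (Term.var w ρ) q').foldl Formula.or
              (Formula.eq (Term.var w ρ) q))) := by
  obtain ⟨q, qs, hq, hqs, h⟩ := FinSet.exists_mem_iff (fun _ => Computable.closed)
    (show FinSet ∅ (Computable (R := R) ∅ ρ) t from hclosed.computable)
  exact ⟨q, qs, hq.closed, fun q' hq' => (hqs q' hq').closed, h⟩
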